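/- Let (X,T,m,α) be a transitive probability preserving Gibbs-Markov map with expansion λ>1, f:X→G with Σ_{a∈α} m(a)Df(a)<∞, and u measurable with f=u-u∘T a.e. Suppose there exists α_1∈α with Du(α_1)<∞. Then Du(a)<∞ for every a∈α, and moreover Σ_{a∈α} m(a)Du(a)<∞. -/

import Mathlib

open MeasureTheory Filter ENNReal

variable {X G ι : Type*}

/-- The essential Lipschitz constant of `f` on the set `Z`:
the infimum of constants `C` such that `edist (f x) (f y) ≤ C * edist x y`
for `x, y` in a full-measure subset of `Z`. -/
noncomputable def essLip [PseudoEMetricSpace X] [PseudoEMetricSpace G] [MeasurableSpace X]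
    (m : Measure X) (f : X → G) (Z : Set X) : ℝ≥0∞ :=
  sInf {C : ℝ≥0∞ | ∃ Ω : Set X, Ω ⊆ Z ∧ m (Z \ Ω) = 0 ∧
    ∀ x ∈ Ω, ∀ y ∈ Ω, edist (f x) (f y) ≤ C * edist x y}

/-- A Gibbs-Markov map: a nonsingular map `T` on a bounded metric probability space
with a countable Markov partition `α` of positive-measure sets, with big images and
preimages, expansion by a factor `lam > 1`, and bounded distortion of the inverse
Jacobian `g`. -/
structure GibbsMarkov [MetricSpace X] [MeasurableSpace X]
    (m : Measure X) (T : X → X) (α : ι → Set X) (lam : ℝ) : Prop where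
  countable : Countable ι
  bounded : Bornology.IsBounded (Set.univ : Set X)
  measT : Measurable T
  meas : ∀ i, MeasurableSet (α i)
  pos : ∀ i, 0 < m (α i)
  disj : Pairwise (Function.onFun Disjoint α)
  cover : m (⋃ i, α i)ᶜ = 0
  inj : ∀ i, Set.InjOn T (α i)
  markov : ∀ i, ∃ s : Set ι, m (symmDiff (T '' α i) (⋃ j ∈ s, α j)) = 0
  bip : ∃ F : Finset ι, ∀ i : ι, (∃ i' ∈ F, m (α i \ T '' α i') = 0) ∧
        (∃ j' ∈ F, m (α j' \ T '' α i) = 0)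
  one_lt_lam : 1 < lam
  expand : ∀ i, ∃ Ω : Set X, Ω ⊆ α i ∧ m (α i \ Ω) = 0 ∧
      ∀ x ∈ Ω, ∀ y ∈ Ω, lam * dist x y ≤ dist (T x) (T y)
  distortion : ∃ g : X → ℝ, (∀ x, 0 < g x) ∧
      (∀ i, ∀ s : Set X, s ⊆ α i → MeasurableSet s →
        m (T '' s) = ∫⁻ x in s, ENNReal.ofReal (g x)⁻¹ ∂m) ∧
      ∃ C : ℝ, 0 < C ∧ ∀ i, ∃ Ω : Set X, Ω ⊆ α i ∧ m (α i \ Ω) = 0 ∧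
        ∀ x ∈ Ω, ∀ y ∈ Ω, |1 - g x / g y| ≤ C * dist (T x) (T y)

/-- `A` is an atom of the partition `α*` generated by the images of the elements
of the partition `α` under `T`. -/
def isImageAtom (T : X → X) (α : ι → Set X) (A : Set X) : Prop :=
  A.Nonempty ∧ ∃ S : Set ι,
    A = (⋂ i ∈ S, T '' α i) ∩ (⋂ i ∈ Sᶜ, (T '' α i)ᶜ)


/-! ### The cleaned-up system -/

/-- The data of a Gibbs-Markov map restricted to a forward invariant full measure set `X0` on which
all the defining properties hold pointwise. -/
structure Good [MetricSpace X] [MeasurableSpace X] [MetricSpace G] [AddCommGroup G]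
    (m : Measure X) (T : X → X) (β : ι → Set X) (X0 : Set X) (c : X → ι) (q Cd Dm : ℝ≥0∞)
    (D : ι → ℝ≥0∞) (f u : X → G) (F : Finset ι) : Prop where
  cnt : Countable ι
  mp : MeasurePreserving T m m
  meas0 : MeasurableSet X0
  conull : m X0ᶜ = 0
  maps : ∀ x ∈ X0, T x ∈ X0
  meas : ∀ i, MeasurableSet (β i)
  sub : ∀ i, β i ⊆ X0
  mem_c : ∀ x ∈ X0, x ∈ β (c x)
  c_eq : ∀ i, ∀ x ∈ β i, c x = i
  pos : ∀ i, m (β i) ≠ 0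
  nullimg : ∀ N ⊆ X0, m N = 0 → m (T '' N) = 0
  nm : ∀ i, ∀ s ⊆ β i, NullMeasurableSet s m → NullMeasurableSet (T '' s) m
  dist1 : ∀ i, ∀ s ⊆ β i, ∀ t ⊆ β i, NullMeasurableSet s m → NullMeasurableSet t m →
    ∀ r : ℝ≥0∞, r ≠ ⊤ → (∀ x ∈ s, ∀ y ∈ t, edist (T x) (T y) ≤ r) →
    m (T '' s) * m t ≤ (1 + Cd * r) * m s * m (T '' t)
  markov : ∀ i j, m (β j \ T '' β i) = 0 ∨ m (β j ∩ T '' β i) = 0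
  bip : ∀ i, ∃ j ∈ F, m (β j \ T '' β i) = 0
  bip2 : ∀ i, ∃ j ∈ F, m (β i \ T '' β j) = 0
  q_lt : q < 1
  Cd_ne : Cd ≠ ⊤
  Dm_ne : Dm ≠ ⊤
  diam : ∀ x y : X, edist x y ≤ Dm
  exp : ∀ i, ∀ x ∈ β i, ∀ y ∈ β i, edist x y ≤ q * edist (T x) (T y)
  lip : ∀ i, ∀ x ∈ β i, ∀ y ∈ β i, edist (f x) (f y) ≤ D i * edist x y
  D_ne : ∀ i, D i ≠ ⊤
  sumD : ∑' i, m (β i) * D i ≠ ⊤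
  cob : ∀ x ∈ X0, f x = u x - u (T x)
  hinv : ∀ g x y : G, edist (g + x) (g + y) = edist x y

/-- Cylinders. -/
def cyl (T : X → X) (β : ι → Set X) (X0 : Set X) : List ι → Set X
  | [] => X0
  | a :: w => β a ∩ T ⁻¹' (cyl T β X0 w)

/-- The weights appearing in the key estimate. -/
noncomputable def phi (q : ℝ≥0∞) (D : ι → ℝ≥0∞) : List ι → ℝ≥0∞
  | [] => 0
  | a :: w => D a * q ^ (w.length + 1) + phi q D w

/-- The itinerary of a point. -/
def word (c : X → ι) (T : X → X) : ℕ → X → List ι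
  | 0, _ => []
  | n + 1, x => c x :: word c T n (T x)

/-- Distortion constants. -/
noncomputable def kap (q Cd Dm : ℝ≥0∞) : List ι → ℝ≥0∞
  | [] => 1
  | _ :: w => (1 + Cd * (q ^ w.length * Dm)) * kap q Cd Dm w

theorem kap_bound (q Cd Dm : ℝ≥0∞) (hq : q < 1) (hC : Cd ≠ ⊤) (hD : Dm ≠ ⊤) :
    ∃ K : ℝ≥0∞, K ≠ ⊤ ∧ ∀ w : List ι, kap q Cd Dm w ≤ K := by
  have hqt : q ≠ ⊤ := (hq.trans one_lt_top).ne
  lift q to NNReal using hqt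
  lift Cd to NNReal using hC
  lift Dm to NNReal using hD
  have hq1 : (q : ℝ) < 1 := by exact_mod_cast hq
  have key : ∀ w : List ι, kap (q : ℝ≥0∞) Cd Dm w ≤
      ENNReal.ofReal (Real.exp (Cd * Dm * ∑ k ∈ Finset.range w.length, (q : ℝ) ^ k)) := by
    intro w
    induction w with
    | nil => simp [kap]
    | cons a w ih =>
      rw [kap, List.length_cons, Finset.sum_range_succ, mul_add, Real.exp_add,
        mul_comm (Real.exp _), ENNReal.ofReal_mul (Real.exp_pos _).le]
      refine mul_le_mul' ?_ ih
      have h : (1 + (Cd : ℝ≥0∞) * ((q : ℝ≥0∞) ^ w.length * Dm)) =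
          ENNReal.ofReal ((Cd * Dm * (q : ℝ) ^ w.length : ℝ) + 1) := by
        have : ((Cd * Dm * (q : ℝ) ^ w.length : ℝ) + 1) =
          ((1 + Cd * (q ^ w.length * Dm) : NNReal) : ℝ) := by push_cast; ring
        rw [this, ENNReal.ofReal_coe_nnreal]; push_cast; rfl
      rw [h]
      exact ENNReal.ofReal_le_ofReal (Real.add_one_le_exp _)
  refine ⟨ENNReal.ofReal (Real.exp (Cd * Dm * (1 - (q : ℝ))⁻¹)), ENNReal.ofReal_ne_top, fun w => ?_⟩
  refine (key w).trans (ENNReal.ofReal_le_ofReal (Real.exp_le_exp.2 ?_))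
  refine mul_le_mul_of_nonneg_left ?_ (by positivity)
  rw [← tsum_geometric_of_lt_one q.coe_nonneg hq1]
  exact (summable_geometric_of_lt_one q.coe_nonneg hq1).sum_le_tsum _ (fun _ _ => by positivity)

theorem word_length (c : X → ι) (T : X → X) (n : ℕ) (x : X) : (word c T n x).length = n := by
  induction n generalizing x with
  | zero => rfl
  | succ n ih => simp [word, ih]

theorem word_take (c : X → ι) (T : X → X) (n k : ℕ) (h : k ≤ n) (x : X) :
    (word c T n x).take k = word c T k x := by
  induction n generalizing x k with
  | zero => obtain rfl : k = 0 := by omega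
            rfl
  | succ n ih =>
    cases k with
    | zero => simp [word]
    | succ k => simp [word, ih k (by omega)]

section good

set_option linter.unusedSectionVars false

variable [MetricSpace X] [MeasurableSpace X] [BorelSpace X] [MetricSpace G] [AddCommGroup G]
    {m : Measure X} [IsProbabilityMeasure m]
    {T : X → X} {β : ι → Set X} {X0 : Set X} {c : X → ι} {q Cd Dm : ℝ≥0∞}
    {D : ι → ℝ≥0∞} {f u : X → G} {F : Finset ι}

theorem Good.cyl_sub (h : Good m T β X0 c q Cd Dm D f u F) (w : List ι) :
    cyl T β X0 w ⊆ X0 := by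
  cases w with
  | nil => exact subset_rfl
  | cons a w => exact Set.inter_subset_left.trans (h.sub a)

theorem Good.cyl_meas (h : Good m T β X0 c q Cd Dm D f u F) (w : List ι) :
    MeasurableSet (cyl T β X0 w) := by
  induction w with
  | nil => exact h.meas0
  | cons a w ih => exact (h.meas a).inter (h.mp.measurable ih)

theorem Good.mem_cyl_word (h : Good m T β X0 c q Cd Dm D f u F) (n : ℕ) (x : X) (hx : x ∈ X0) :
    x ∈ cyl T β X0 (word c T n x) := by
  induction n generalizing x with
  | zero => exact hx
  | succ n ih => exact ⟨h.mem_c x hx, ih _ (h.maps x hx)⟩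

theorem Good.word_eq (h : Good m T β X0 c q Cd Dm D f u F) (w : List ι) (x : X)
    (hx : x ∈ cyl T β X0 w) : word c T w.length x = w := by
  induction w generalizing x with
  | nil => rfl
  | cons a w ih => simp [word, h.c_eq a x hx.1, ih _ hx.2]

theorem Good.cyl_dist (h : Good m T β X0 c q Cd Dm D f u F) (w : List ι) (x y : X)
    (hx : x ∈ cyl T β X0 w) (hy : y ∈ cyl T β X0 w) :
    edist x y ≤ q ^ w.length * edist (T^[w.length] x) (T^[w.length] y) := by
  induction w generalizing x y with
  | nil => simp
  | cons a w ih =>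
    refine (h.exp a x hx.1 y hy.1).trans ?_
    rw [List.length_cons, pow_succ', mul_assoc]
    exact mul_le_mul_right (ih _ _ hx.2 hy.2) q

theorem Good.cyl_diam (h : Good m T β X0 c q Cd Dm D f u F) (w : List ι) (x y : X)
    (hx : x ∈ cyl T β X0 w) (hy : y ∈ cyl T β X0 w) :
    edist x y ≤ q ^ w.length * Dm :=
  (h.cyl_dist w x y hx hy).trans (mul_le_mul_right (h.diam _ _) _)

theorem Good.edist_step (h : Good m T β X0 c q Cd Dm D f u F) (x y : X) (hx : x ∈ X0)
    (hy : y ∈ X0) : edist (u (T x)) (u (T y)) ≤ edist (u x) (u y) + edist (f x) (f y) := by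
  have ex : u (T x) = u x - f x := by rw [h.cob x hx]; abel
  have ey : u (T y) = u y - f y := by rw [h.cob y hy]; abel
  rw [ex, ey]
  refine (edist_triangle _ (u y - f x) _).trans (add_le_add ?_ ?_)
  · rw [sub_eq_neg_add, sub_eq_neg_add, h.hinv]
  · have := h.hinv (f x + f y - u y) (u y - f x) (u y - f y)
    rw [← this]
    have e1 : f x + f y - u y + (u y - f x) = f y := by abel
    have e2 : f x + f y - u y + (u y - f y) = f x := by abel
    rw [e1, e2, edist_comm]

theorem Good.cyl_u (h : Good m T β X0 c q Cd Dm D f u F) (w : List ι) (x y : X)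
    (hx : x ∈ cyl T β X0 w) (hy : y ∈ cyl T β X0 w) :
    edist (u (T^[w.length] x)) (u (T^[w.length] y)) ≤
      edist (u x) (u y) + phi q D w * edist (T^[w.length] x) (T^[w.length] y) := by
  induction w generalizing x y with
  | nil => simp
  | cons a w ih =>
    have h1 := ih _ _ hx.2 hy.2
    have h2 := h.edist_step x y (h.sub a hx.1) (h.sub a hy.1)
    have h3 := h.lip a x hx.1 y hy.1
    have h4 := h.cyl_dist (a :: w) x y hx hy
    simp only [List.length_cons, Function.iterate_succ, Function.comp_apply] at h1 h2 h3 h4 ⊢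
    set d := edist (T^[w.length] (T x)) (T^[w.length] (T y))
    calc _ ≤ _ := h1
      _ ≤ (edist (u x) (u y) + D a * (q ^ (w.length + 1) * d)) + phi q D w * d := by
        gcongr
        refine h2.trans (by gcongr; exact h3.trans (by gcongr))
      _ = _ := by rw [phi]; ring

theorem Good.iter_maps (h : Good m T β X0 c q Cd Dm D f u F) (n : ℕ) (x : X) (hx : x ∈ X0) :
    T^[n] x ∈ X0 := by
  induction n generalizing x with
  | zero => exact hx
  | succ n ih => exact ih _ (h.maps x hx)

theorem Good.iter_null (h : Good m T β X0 c q Cd Dm D f u F) (n : ℕ) (N : Set X) (hN : N ⊆ X0)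
    (h0 : m N = 0) : m (T^[n] '' N) = 0 := by
  induction n generalizing N with
  | zero => simpa using h0
  | succ n ih =>
    rw [Function.iterate_succ, Set.image_comp]
    refine ih _ ?_ (h.nullimg N hN h0)
    rintro _ ⟨x, hx, rfl⟩
    exact h.maps x (hN hx)

theorem Good.le_image (h : Good m T β X0 c q Cd Dm D f u F) (s : Set X) : m s ≤ m (T '' s) := by
  rw [← measure_toMeasurable (T '' s), ← h.mp.measure_preimage
    (measurableSet_toMeasurable _ _).nullMeasurableSet]
  exact measure_mono fun x hx => subset_toMeasurable _ _ ⟨x, hx, rfl⟩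

theorem Good.distortion (h : Good m T β X0 c q Cd Dm D f u F) (w : List ι) (s t : Set X)
    (hs : s ⊆ cyl T β X0 w) (ht : t ⊆ cyl T β X0 w) (hsm : NullMeasurableSet s m)
    (htm : NullMeasurableSet t m) :
    m (T^[w.length] '' s) * m t ≤ kap q Cd Dm w * m s * m (T^[w.length] '' t) := by
  induction w generalizing s t with
  | nil => simp [kap]
  | cons a w ih =>
    have hs' : T '' s ⊆ cyl T β X0 w := by rintro _ ⟨x, hx, rfl⟩; exact (hs hx).2
    have ht' : T '' t ⊆ cyl T β X0 w := by rintro _ ⟨x, hx, rfl⟩; exact (ht hx).2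
    have hsa : s ⊆ β a := fun x hx => (hs hx).1
    have hta : t ⊆ β a := fun x hx => (ht hx).1
    have h1 := ih (T '' s) (T '' t) hs' ht' (h.nm a s hsa hsm) (h.nm a t hta htm)
    have hr : q ^ w.length * Dm ≠ ⊤ :=
      ENNReal.mul_ne_top (ENNReal.pow_ne_top (h.q_lt.trans one_lt_top).ne) h.Dm_ne
    have h2 := h.dist1 a s hsa t hta hsm htm _ hr
      (fun x hx y hy => h.cyl_diam w _ _ (hs hx).2 (ht hy).2)
    rw [List.length_cons, Function.iterate_succ, Set.image_comp, Set.image_comp, kap]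
    by_cases hs0 : m (T '' s) = 0
    · rw [h.iter_null _ _ (hs'.trans (h.cyl_sub w)) hs0]; simp
    by_cases ht0 : m (T '' t) = 0
    · have : m t = 0 := le_antisymm ((h.le_image t).trans ht0.le) bot_le
      rw [this]; simp
    have e : m (T '' s) * m (T '' t) ≠ 0 := mul_ne_zero hs0 ht0
    have e' : m (T '' s) * m (T '' t) ≠ ⊤ := ENNReal.mul_ne_top (by finiteness) (by finiteness)
    rw [← ENNReal.mul_le_mul_iff_right e e']
    calc _ = (m (T^[w.length] '' (T '' s)) * m (T '' t)) * (m (T '' s) * m t) := by ring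
      _ ≤ _ := mul_le_mul' h1 h2
      _ = _ := by ring

theorem Good.image_big (h : Good m T β X0 c q Cd Dm D f u F) (w : List ι) (hw : w ≠ [])
    (hpos : m (cyl T β X0 w) ≠ 0) :
    ∃ a, m (T '' β a \ T^[w.length] '' cyl T β X0 w) = 0 := by
  induction w with
  | nil => exact absurd rfl hw
  | cons a w ih =>
    cases w with
    | nil =>
      refine ⟨a, ?_⟩
      have : cyl T β X0 [a] = β a := by
        ext x; exact ⟨fun hx => hx.1, fun hx => ⟨hx, h.maps x (h.sub a hx)⟩⟩
      simp [this]
    | cons b w =>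
      set w' := b :: w with hw'
      have him : T '' cyl T β X0 (a :: w') = T '' β a ∩ cyl T β X0 w' := by
        rw [cyl, Set.image_inter_preimage]
      have hp : m (T '' β a ∩ cyl T β X0 w') ≠ 0 := by
        rw [← him]; intro h0
        exact hpos (le_antisymm ((h.le_image _).trans h0.le) bot_le)
      have hp1 : m (cyl T β X0 w') ≠ 0 := fun h0 => hp (measure_mono_null Set.inter_subset_right h0)
      obtain ⟨a', ha'⟩ := ih (by simp [hw']) hp1
      refine ⟨a', ?_⟩
      have hsub : cyl T β X0 w' ⊆ β b := Set.inter_subset_left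
      have hb : m (β b \ T '' β a) = 0 := by
        refine (h.markov a b).resolve_right fun h0 => hp (measure_mono_null ?_ h0)
        exact fun x hx => ⟨hsub hx.2, hx.1⟩
      have hN : m (T^[w'.length] '' (cyl T β X0 w' \ T '' β a)) = 0 :=
        h.iter_null _ _ (Set.sdiff_subset.trans (h.cyl_sub _))
          (measure_mono_null (Set.sdiff_subset_sdiff_left hsub) hb)
      refine measure_mono_null ?_ (measure_union_null ha' hN)
      rw [List.length_cons, Function.iterate_succ, Set.image_comp, him]
      rintro y ⟨hy, hy'⟩
      by_cases hyc : y ∈ T^[w'.length] '' cyl T β X0 w'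
      · obtain ⟨z, hz, rfl⟩ := hyc
        right
        refine ⟨z, ⟨hz, fun hza => hy' ⟨z, ⟨hza, hz⟩, rfl⟩⟩, rfl⟩
      · exact Or.inl ⟨hy, hyc⟩

theorem exists_small (F : Finset ι) (φ : ι → ℝ≥0∞) (hφ : ∀ j ∈ F, φ j ≠ 0) :
    ∃ δ : ℝ≥0∞, δ ≠ 0 ∧ δ ≠ ⊤ ∧ ∀ j ∈ F, δ < φ j := by
  have : ∀ j ∈ F, ∀ᶠ δ in nhdsWithin (0 : ℝ≥0∞) (Set.Ioi 0), δ < φ j := fun j hj =>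
    nhdsWithin_le_nhds (eventually_lt_nhds (pos_iff_ne_zero.2 (hφ j hj)))
  have h2 : ∀ᶠ δ in nhdsWithin (0 : ℝ≥0∞) (Set.Ioi 0), δ < 1 :=
    nhdsWithin_le_nhds (eventually_lt_nhds one_pos)
  obtain ⟨δ, h1, h2, h3⟩ := (((eventually_all_finset F).2 this).and
    (h2.and self_mem_nhdsWithin)).exists
  exact ⟨δ, (ne_of_gt h3), (h2.trans one_lt_top).ne, h1⟩

/-- Density lemma: a positive measure set almost fills a cylinder whose word satisfies `P`. -/
theorem Good.density (h : Good m T β X0 c q Cd Dm D f u F) (A : Set X) (hA : MeasurableSet A)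
    (hA0 : m A ≠ 0) (P : List ι → Prop)
    (hP : ∀ᵐ x ∂m, x ∈ A → x ∈ X0 → ∃ᶠ n in atTop, P (word c T n x))
    (δ : ℝ≥0∞) (hδ : δ ≠ 0) :
    ∃ w, w ≠ [] ∧ P w ∧ m (cyl T β X0 w \ A) < δ * m (cyl T β X0 w) := by
  have := h.cnt
  by_contra! hcon
  obtain ⟨U, hAU, hUo, hU⟩ := A.exists_isOpen_lt_add (μ := m) (by finiteness)
    (mul_ne_zero hδ hA0)
  set W : Set (List ι) := {w | w ≠ [] ∧ P w ∧ cyl T β X0 w ⊆ U} with hW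
  set M : Set (List ι) := {w | w ∈ W ∧ ∀ k < w.length, w.take k ∉ W} with hM
  have hcov : ∀ᵐ x ∂m, x ∈ A → x ∈ ⋃ w : M, cyl T β X0 w := by
    have hX0 : ∀ᵐ x ∂m, x ∈ X0 := h.conull
    filter_upwards [hP, hX0] with x hx hx0 hxA
    have hfr := hx hxA hx0
    have hex : ∃ n, word c T n x ∈ W := by
      obtain ⟨r, hr, hball⟩ := EMetric.isOpen_iff.1 hUo x (hAU hxA)
      have hlim : Tendsto (fun n => q ^ n * Dm) atTop (nhds 0) := by
        have := ENNReal.Tendsto.mul_const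
          (ENNReal.tendsto_pow_atTop_nhds_zero_of_lt_one h.q_lt) (Or.inr h.Dm_ne)
        simpa using this
      obtain ⟨n, hn1, hn2, hn3⟩ :=
        (hfr.and_eventually ((hlim.eventually_lt_const hr).and (eventually_ge_atTop 1))).exists
      refine ⟨n, ?_, hn1, fun y hy => hball ?_⟩
      · intro h0
        have := congrArg List.length h0
        rw [word_length] at this
        simp at this; omega
      · have := h.cyl_diam _ y x hy (h.mem_cyl_word n x hx0)
        rw [word_length] at this
        exact lt_of_le_of_lt this hn2
    classical
    refine Set.mem_iUnion.2 ⟨⟨word c T (Nat.find hex) x, Nat.find_spec hex, fun k hk => ?_⟩,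
      h.mem_cyl_word _ x hx0⟩
    rw [word_length] at hk
    rw [word_take _ _ _ _ hk.le]
    exact Nat.find_min hex hk
  have hdisj : Pairwise (Function.onFun Disjoint fun w : M => cyl T β X0 (w : List ι)) := by
    have aux : ∀ (w w' : M), w.1.length ≤ w'.1.length → ∀ x, x ∈ cyl T β X0 w.1 →
        x ∈ cyl T β X0 w'.1 → w = w' := by
      intro w w' hle x hx hx'
      have e1 := h.word_eq _ _ hx
      have e2 := h.word_eq _ _ hx'
      rcases hle.lt_or_eq with hlt | heq
      · exfalso
        apply w'.2.2 _ hlt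
        rw [← e2, word_take _ _ _ _ hle, e1]
        exact w.2.1
      · apply Subtype.ext
        rw [← e1, ← e2, heq]
    intro w w' hne
    refine Set.disjoint_left.2 fun x hx hx' => hne ?_
    rcases le_total w.1.length w'.1.length with hl | hl
    · exact aux w w' hl x hx hx'
    · exact (aux w' w hl x hx' hx).symm
  have h1 : m A ≤ ∑' w : M, m (cyl T β X0 w) :=
    (measure_mono_ae hcov).trans (measure_iUnion_le _)
  have h2 : ∑' w : M, m (cyl T β X0 w \ A) ≤ m (U \ A) := by
    rw [← measure_iUnion (fun w w' hne => (hdisj hne).mono Set.sdiff_subset Set.sdiff_subset)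
      (fun w => (h.cyl_meas _).diff hA)]
    refine measure_mono (Set.iUnion_subset fun w => Set.sdiff_subset_sdiff_left w.2.1.2.2)
  have h3 : m (U \ A) < δ * m A := by
    rw [measure_sdiff hAU hA.nullMeasurableSet (by finiteness)]
    exact ENNReal.sub_lt_of_lt_add (measure_mono hAU) (by rwa [add_comm])
  have h4 : δ * m A ≤ m (U \ A) := by
    calc δ * m A ≤ δ * ∑' w : M, m (cyl T β X0 w) := by gcongr
      _ = ∑' w : M, δ * m (cyl T β X0 w) := ENNReal.tsum_mul_left.symm
      _ ≤ ∑' w : M, m (cyl T β X0 w \ A) :=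
        ENNReal.tsum_le_tsum fun w => hcon w w.2.1.1 w.2.1.2.1
      _ ≤ _ := h2
  exact absurd h3 (not_lt.2 h4)

theorem Good.key (h : Good m T β X0 c q Cd Dm D f u F) (A : Set X) (hA : MeasurableSet A)
    (hA0 : m A ≠ 0) (P : List ι → Prop)
    (hP : ∀ᵐ x ∂m, x ∈ A → x ∈ X0 → ∃ᶠ n in atTop, P (word c T n x))
    (δ : ℝ≥0∞) (hδ : δ ≠ 0) :
    ∃ w, P w ∧ ∃ j ∈ F, m (β j \ T^[w.length] '' (cyl T β X0 w ∩ A)) ≤ δ := by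
  obtain ⟨K, hK, hKw⟩ := kap_bound (ι := ι) q Cd Dm h.q_lt h.Cd_ne h.Dm_ne
  have hδ' : δ / (K + 1) ≠ 0 := (ENNReal.div_pos hδ (by finiteness)).ne'
  obtain ⟨w, hw, hPw, hlt⟩ := h.density A hA hA0 P hP (δ / (K + 1)) hδ'
  have hpos : m (cyl T β X0 w) ≠ 0 := by
    intro h0; rw [h0] at hlt; simp at hlt
  obtain ⟨a, ha⟩ := h.image_big w hw hpos
  obtain ⟨j, hj, hja⟩ := h.bip a
  refine ⟨w, hPw, j, hj, ?_⟩
  have hd := h.distortion w (cyl T β X0 w \ A) (cyl T β X0 w) Set.sdiff_subset subset_rfl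
    ((h.cyl_meas w).diff hA).nullMeasurableSet (h.cyl_meas w).nullMeasurableSet
  have hb : m (T^[w.length] '' (cyl T β X0 w \ A)) ≤ δ := by
    rw [← ENNReal.mul_le_mul_iff_left hpos (by finiteness)]
    calc _ ≤ _ := hd
      _ ≤ (K + 1) * (δ / (K + 1) * m (cyl T β X0 w)) * 1 := by
        gcongr
        · exact (hKw w).trans le_self_add
        · exact prob_le_one
      _ = δ * m (cyl T β X0 w) := by
        rw [mul_one, ← mul_assoc, ENNReal.mul_div_cancel (by simp) (by finiteness)]
  have hsub : β j \ T^[w.length] '' (cyl T β X0 w ∩ A) ⊆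
      (β j \ T '' β a) ∪ (T '' β a \ T^[w.length] '' cyl T β X0 w) ∪
        T^[w.length] '' (cyl T β X0 w \ A) := by
    rintro y ⟨hy, hy'⟩
    by_cases h1 : y ∈ T '' β a
    · by_cases h2 : y ∈ T^[w.length] '' cyl T β X0 w
      · obtain ⟨z, hz, rfl⟩ := h2
        exact Or.inr ⟨z, ⟨hz, fun hzA => hy' ⟨z, ⟨hz, hzA⟩, rfl⟩⟩, rfl⟩
      · exact Or.inl (Or.inr ⟨h1, h2⟩)
    · exact Or.inl (Or.inl ⟨hy, h1⟩)
  calc _ ≤ _ := measure_mono hsub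
    _ ≤ _ := measure_union_le _ _
    _ ≤ 0 + δ := add_le_add (measure_union_null hja ha).le hb
    _ = δ := zero_add _

theorem Good.invariant (h : Good m T β X0 c q Cd Dm D f u F) (A : Set X) (hA : MeasurableSet A)
    (hA0 : m A ≠ 0) (hinvA : ∀ x ∈ X0, x ∈ A → T x ∈ A) : ∃ j ∈ F, m (β j \ A) = 0 := by
  by_contra! hcon
  obtain ⟨δ, h0, -, hF⟩ := exists_small F _ hcon
  obtain ⟨w, -, j, hj, hle⟩ := h.key A hA hA0 (fun _ => True)
    (Eventually.of_forall fun _ _ _ => Frequently.of_forall fun _ => trivial) δ h0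
  refine absurd (hF j hj) (not_lt.2 (le_trans (measure_mono ?_) hle))
  refine Set.sdiff_subset_sdiff_right ?_
  rintro _ ⟨x, hx, rfl⟩
  have : ∀ n, T^[n] x ∈ A := by
    intro n
    induction n with
    | zero => exact hx.2
    | succ n ih =>
      rw [Function.iterate_succ_apply']
      exact hinvA _ (h.iter_maps n x (h.cyl_sub w hx.1)) ih
  exact this _

/-- Measurable version of `D ∘ c`. -/
noncomputable def dd (β : ι → Set X) (D : ι → ℝ≥0∞) (x : X) : ℝ≥0∞ :=
  ∑' i, (β i).indicator (fun _ => D i) x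

/-- Measurable version of the weights along orbits. -/
noncomputable def Phi (T : X → X) (β : ι → Set X) (q : ℝ≥0∞) (D : ι → ℝ≥0∞) : ℕ → X → ℝ≥0∞
  | 0, _ => 0
  | n + 1, x => dd β D x * q ^ (n + 1) + Phi T β q D n (T x)

theorem Good.dd_eq (h : Good m T β X0 c q Cd Dm D f u F) (x : X) (hx : x ∈ X0) :
    dd β D x = D (c x) := by
  rw [dd, tsum_eq_single (c x)]
  · exact Set.indicator_of_mem (h.mem_c x hx) _
  · intro i hi
    exact Set.indicator_of_notMem (fun hxi => hi (h.c_eq i x hxi).symm) _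

theorem Good.Phi_eq (h : Good m T β X0 c q Cd Dm D f u F) (n : ℕ) (x : X) (hx : x ∈ X0) :
    Phi T β q D n x = phi q D (word c T n x) := by
  induction n generalizing x with
  | zero => rfl
  | succ n ih => rw [Phi, word, phi, h.dd_eq x hx, ih _ (h.maps x hx), word_length]

theorem Good.dd_meas (h : Good m T β X0 c q Cd Dm D f u F) : Measurable (dd β D) := by
  have := h.cnt
  exact Measurable.tsum fun i => measurable_const.indicator (h.meas i)

theorem Good.Phi_meas (h : Good m T β X0 c q Cd Dm D f u F) (n : ℕ) :
    Measurable (Phi T β q D n) := by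
  induction n with
  | zero => exact measurable_const
  | succ n ih => exact (h.dd_meas.mul_const _).add (ih.comp h.mp.measurable)

theorem Good.Phi_int (h : Good m T β X0 c q Cd Dm D f u F) (n : ℕ) :
    ∫⁻ x, Phi T β q D n x ∂m ≤ (∑' i, m (β i) * D i) * (1 - q)⁻¹ := by
  have := h.cnt
  have hdd : ∫⁻ x, dd β D x ∂m = ∑' i, m (β i) * D i := by
    unfold dd
    rw [lintegral_tsum fun i => (measurable_const.indicator (h.meas i)).aemeasurable]
    refine tsum_congr fun i => ?_
    rw [lintegral_indicator_const (h.meas i), mul_comm]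
  have hk : ∀ n, ∫⁻ x, Phi T β q D n x ∂m =
      (∑' i, m (β i) * D i) * ∑ k ∈ Finset.range n, q ^ (k + 1) := by
    intro n
    induction n with
    | zero => simp [Phi]
    | succ n ih =>
      simp only [Phi]
      rw [lintegral_add_left (h.dd_meas.mul_const _), lintegral_mul_const _ h.dd_meas, hdd,
        h.mp.lintegral_comp (h.Phi_meas n), ih, Finset.sum_range_succ]
      ring
  rw [hk, ← ENNReal.tsum_geometric]
  gcongr
  calc ∑ k ∈ Finset.range n, q ^ (k + 1) ≤ ∑ k ∈ Finset.range n, q ^ k := by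
        refine Finset.sum_le_sum fun k _ => ?_
        rw [pow_succ]
        exact mul_le_of_le_one_right' h.q_lt.le
    _ ≤ _ := ENNReal.sum_le_tsum _

theorem Good.phi_bound (h : Good m T β X0 c q Cd Dm D f u F) :
    ∃ C : ℝ≥0∞, C ≠ ⊤ ∧ ∀ᵐ x ∂m, x ∈ X0 → ∃ᶠ n in atTop, phi q D (word c T n x) ≤ C := by
  set L : X → ℝ≥0∞ := fun x => liminf (fun n => Phi T β q D n x) atTop with hL
  have hLm : Measurable L := Measurable.liminf h.Phi_meas
  set M : ℝ≥0∞ := (∑' i, m (β i) * D i) * (1 - q)⁻¹ with hM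
  have hMt : M ≠ ⊤ := ENNReal.mul_ne_top h.sumD
    (ENNReal.inv_ne_top.2 (tsub_pos_of_lt h.q_lt).ne')
  have hLint : ∫⁻ x, L x ∂m ≤ M := by
    refine (lintegral_liminf_le h.Phi_meas).trans ?_
    refine liminf_le_of_le (by isBoundedDefault) fun b hb => ?_
    obtain ⟨n, hn⟩ := hb.exists
    exact hn.trans (h.Phi_int n)
  obtain ⟨δ, h0, ht, hF⟩ := exists_small F (fun j => m (β j)) (fun j _ => h.pos j)
  set C : ℝ≥0∞ := (M + 1) / δ with hC
  have hCt : C ≠ ⊤ := ENNReal.div_ne_top (by finiteness) h0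
  have hLT : ∀ x ∈ X0, L x ≤ L (T x) := by
    intro x hx
    have e : L x = liminf (fun n => Phi T β q D (n + 1) x) atTop :=
      (liminf_nat_add (fun n => Phi T β q D n x) 1).symm
    have hz : Tendsto (fun n => dd β D x * q ^ (n + 1)) atTop (nhds 0) := by
      have hd : dd β D x ≠ ⊤ := by rw [h.dd_eq x hx]; exact h.D_ne _
      have h1 := (ENNReal.tendsto_pow_atTop_nhds_zero_of_lt_one h.q_lt).comp (tendsto_add_atTop_nat 1)
      have := ENNReal.Tendsto.const_mul h1 (Or.inr hd)
      simpa using this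
    rw [e]
    simp only [Phi]
    exact (ENNReal.liminf_add_of_left_tendsto_zero hz (fun n => Phi T β q D n (T x))).le
  set A : Set X := X0 ∩ {x | C ≤ L x} with hA
  have hAm : MeasurableSet A := h.meas0.inter (measurableSet_le measurable_const hLm)
  have hA0 : m A = 0 := by
    by_contra hne
    obtain ⟨j, hj, hjA⟩ := h.invariant A hAm hne
      (fun x hx hxA => ⟨h.maps x hx, le_trans hxA.2 (hLT x hx)⟩)
    have h1 : m (β j) ≤ m A := by
      calc m (β j) ≤ m (β j \ A ∪ A) := measure_mono fun x hx => by
            by_cases hxA : x ∈ A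
            · exact Or.inr hxA
            · exact Or.inl ⟨hx, hxA⟩
        _ ≤ _ := measure_union_le _ _
        _ = _ := by rw [hjA, zero_add]
    have h2 : C * m A ≤ M := by
      calc C * m A ≤ C * m {x | C ≤ L x} := by gcongr; exact Set.inter_subset_right
        _ ≤ _ := mul_meas_ge_le_lintegral hLm C
        _ ≤ M := hLint
    have h3 : M + 1 ≤ M := by
      calc M + 1 = C * δ := (ENNReal.div_mul_cancel h0 ht).symm
        _ ≤ C * m A := by gcongr; exact (hF j hj).le.trans h1
        _ ≤ M := h2
    exact absurd h3 (not_le.2 (ENNReal.lt_add_right hMt one_ne_zero))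
  refine ⟨C, hCt, ?_⟩
  filter_upwards [measure_eq_zero_iff_ae_notMem.1 hA0] with x hx hx0
  have hlt : L x < C := by
    by_contra hge
    exact hx ⟨hx0, not_lt.1 hge⟩
  refine (frequently_lt_of_liminf_lt (by isBoundedDefault) hlt).mono fun n hn => ?_
  rw [← h.Phi_eq n x hx0]
  exact hn.le

theorem Good.atom (h : Good m T β X0 c q Cd Dm D f u F) {Q : Type*} (v : X → Q)
    (hv : ∀ S : Set Q, MeasurableSet (v ⁻¹' S)) (hvT : ∀ x ∈ X0, v (T x) = v x)
    (B : Set X) (hB : MeasurableSet B) (hBX : B ⊆ X0) (hB0 : m B ≠ 0)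
    (hBT : ∀ x ∈ B, T x ∈ B) : ∃ p, m (B ∩ v ⁻¹' {p}) ≠ 0 := by
  classical
  have := h.cnt
  have hfull : ∀ S : Set Q, m (B ∩ v ⁻¹' S) ≠ 0 → ∃ j ∈ F, m (β j \ (B ∩ v ⁻¹' S)) = 0 := by
    intro S hS
    refine h.invariant _ (hB.inter (hv S)) hS ?_
    rintro x hx ⟨hxB, hxS⟩
    refine ⟨hBT x hxB, ?_⟩
    rw [Set.mem_preimage, hvT x hx]
    exact hxS
  set J : Set Q → Finset ι := fun S => F.filter fun j => m (β j \ (B ∩ v ⁻¹' S)) = 0 with hJ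
  have hne : ∃ n, ∃ S : Set Q, m (B ∩ v ⁻¹' S) ≠ 0 ∧ (J S).card = n :=
    ⟨_, Set.univ, by simpa using hB0, rfl⟩
  obtain ⟨S, hS, hcard⟩ := Nat.find_spec hne
  have hmin : ∀ S', m (B ∩ v ⁻¹' S') ≠ 0 → (J S).card ≤ (J S').card := by
    intro S' hS'
    rw [hcard]
    exact Nat.find_min' hne ⟨S', hS', rfl⟩
  have hmono : ∀ S' ⊆ S, J S' ⊆ J S := by
    intro S' hS' j hj
    rw [hJ, Finset.mem_filter] at hj ⊢
    exact ⟨hj.1, measure_mono_null (Set.sdiff_subset_sdiff_right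
      (Set.inter_subset_inter_right _ (Set.preimage_mono hS'))) hj.2⟩
  have hat : ∀ S' ⊆ S, m (B ∩ v ⁻¹' S') ≠ 0 → m (B ∩ v ⁻¹' (S \ S')) = 0 := by
    intro S' hS' h1
    by_contra h2
    have e1 := Finset.eq_of_subset_of_card_le (hmono S' hS') (hmin S' h1)
    have e2 := Finset.eq_of_subset_of_card_le (hmono (S \ S') Set.sdiff_subset) (hmin _ h2)
    obtain ⟨j, hjF, hj⟩ := hfull S' h1
    have hj1 : j ∈ J S' := Finset.mem_filter.2 ⟨hjF, hj⟩
    rw [e1, ← e2] at hj1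
    have hj2 := (Finset.mem_filter.1 hj1).2
    refine h.pos j (measure_mono_null ?_ (measure_union_null hj hj2))
    intro x hx
    by_cases hxS : x ∈ B ∩ v ⁻¹' S'
    · exact Or.inr ⟨hx, fun hx2 => hx2.2.2 hxS.2⟩
    · exact Or.inl ⟨hx, hxS⟩
  -- a section of `v`
  have hsec : ∀ p : Q, ∃ y : X, (∃ x ∈ X0, v x = p) → y ∈ X0 ∧ v y = p := by
    intro p
    by_cases hp : ∃ x ∈ X0, v x = p
    · obtain ⟨x, hx⟩ := hp
      exact ⟨x, fun _ => hx⟩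
    · obtain ⟨x, hx⟩ : B.Nonempty := by
        by_contra h0
        rw [Set.not_nonempty_iff_eq_empty.1 h0] at hB0
        simp at hB0
      exact ⟨x, fun h' => absurd h' hp⟩
  choose r hr using hsec
  have hwn : ∀ n : ℕ, ∃ w : List ι, w.length = n ∧
      m (B ∩ v ⁻¹' {p | p ∈ S ∧ r p ∈ cyl T β X0 w}) ≠ 0 := by
    intro n
    by_contra! hcon
    apply hS
    refine measure_mono_null (t := ⋃ w : {w : List ι // w.length = n},
      B ∩ v ⁻¹' {p | p ∈ S ∧ r p ∈ cyl T β X0 w}) ?_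
      (measure_iUnion_null fun w => hcon w.1 w.2)
    rintro x ⟨hxB, hxS⟩
    have := (hr (v x) ⟨x, hBX hxB, rfl⟩).1
    exact Set.mem_iUnion.2 ⟨⟨word c T n (r (v x)), word_length _ _ _ _⟩, hxB, hxS,
      h.mem_cyl_word n _ this⟩
  choose w hwl hw using hwn
  have hI : m (B ∩ v ⁻¹' S ∩ ⋂ n, v ⁻¹' {p | r p ∈ cyl T β X0 (w n)}) ≠ 0 := by
    intro h0
    apply hS
    refine measure_mono_null (t := (B ∩ v ⁻¹' S ∩ ⋂ n, v ⁻¹' {p | r p ∈ cyl T β X0 (w n)}) ∪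
      ⋃ n, B ∩ v ⁻¹' (S \ {p | p ∈ S ∧ r p ∈ cyl T β X0 (w n)})) ?_
      (measure_union_null h0 (measure_iUnion_null fun n => hat _ (fun p hp => hp.1) (hw n)))
    rintro x ⟨hxB, hxS⟩
    by_cases hx : ∀ n, r (v x) ∈ cyl T β X0 (w n)
    · exact Or.inl ⟨⟨hxB, hxS⟩, Set.mem_iInter.2 hx⟩
    · push Not at hx
      obtain ⟨n, hn⟩ := hx
      exact Or.inr (Set.mem_iUnion.2 ⟨n, hxB, hxS, fun h' => hn h'.2⟩)
  obtain ⟨x, ⟨hxB, hxS⟩, hx⟩ := nonempty_of_measure_ne_zero hI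
  refine ⟨v x, fun h0 => hI (measure_mono_null ?_ h0)⟩
  rintro y ⟨⟨hyB, hyS⟩, hy⟩
  refine ⟨hyB, ?_⟩
  have hd : edist (r (v y)) (r (v x)) = 0 := by
    have hlim : Tendsto (fun n => q ^ n * Dm) atTop (nhds 0) := by
      have := ENNReal.Tendsto.mul_const
        (ENNReal.tendsto_pow_atTop_nhds_zero_of_lt_one h.q_lt) (Or.inr h.Dm_ne)
      simpa using this
    refine le_antisymm (ge_of_tendsto' hlim fun n => ?_) bot_le
    have := h.cyl_diam (w n) _ _ (Set.mem_iInter.1 hy n) (Set.mem_iInter.1 hx n)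
    rwa [hwl n] at this
  have e1 := (hr (v y) ⟨y, hBX hyB, rfl⟩).2
  have e2 := (hr (v x) ⟨x, hBX hxB, rfl⟩).2
  rw [Set.mem_preimage, Set.mem_singleton_iff, ← e1, edist_eq_zero.1 hd, e2]

theorem Good.separable (h : Good m T β X0 c q Cd Dm D f u F) :
    TopologicalSpace.IsSeparable X0 := by
  have := h.cnt
  obtain ⟨t, -, htc, ht⟩ := EMetric.subset_countable_closure_of_almost_dense_set X0 (by
    intro ε hε
    have hlim : Tendsto (fun n => q ^ n * Dm) atTop (nhds 0) := by
      have := ENNReal.Tendsto.mul_const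
        (ENNReal.tendsto_pow_atTop_nhds_zero_of_lt_one h.q_lt) (Or.inr h.Dm_ne)
      simpa using this
    obtain ⟨n, hn⟩ := (hlim.eventually_lt_const hε).exists
    refine ⟨Set.range fun w : {w : List ι // (cyl T β X0 w).Nonempty} => w.2.some,
      Set.countable_range _, fun x hx => ?_⟩
    have hxw := h.mem_cyl_word n x hx
    refine Set.mem_iUnion₂.2 ⟨_, ⟨⟨word c T n x, ⟨x, hxw⟩⟩, rfl⟩, ?_⟩
    have := h.cyl_diam _ _ _ hxw (Set.Nonempty.some_mem (⟨x, hxw⟩ : (cyl T β X0 _).Nonempty))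
    rw [word_length] at this
    exact this.trans hn.le)
  exact ⟨t, htc, ht⟩

theorem Good.separable_f (h : Good m T β X0 c q Cd Dm D f u F) :
    TopologicalSpace.IsSeparable (f '' X0) := by
  have := h.cnt
  have hi : ∀ i, TopologicalSpace.IsSeparable (f '' β i) := by
    intro i
    have hs : TopologicalSpace.SeparableSpace (β i) :=
      (h.separable.mono (h.sub i)).separableSpace
    have hl : LipschitzOnWith (D i).toNNReal f (β i) := by
      intro x hx y hy
      rw [ENNReal.coe_toNNReal (h.D_ne i)]
      exact h.lip i x hx y hy
    rw [← Set.range_domRestrict]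
    exact TopologicalSpace.isSeparable_range hl.continuousOn.domRestrict
  refine (TopologicalSpace.IsSeparable.iUnion hi).mono ?_
  rintro _ ⟨x, hx, rfl⟩
  exact Set.mem_iUnion.2 ⟨c x, x, h.mem_c x hx, rfl⟩

theorem topGroup_of_inv (hinv : ∀ g x y : G, edist (g + x) (g + y) = edist x y) :
    IsTopologicalAddGroup G where
  continuous_add := by
    have : ∀ p r : G × G, edist (p.1 + p.2) (r.1 + r.2) ≤ edist p.1 r.1 + edist p.2 r.2 := by
      intro p r
      refine (edist_triangle _ (r.1 + p.2) _).trans (add_le_add ?_ ?_)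
      · rw [add_comm p.1, add_comm r.1, hinv]
      · rw [hinv]
    have hl : LipschitzWith 2 fun p : G × G => p.1 + p.2 := by
      intro p r
      refine (this p r).trans ?_
      have : ((2 : NNReal) : ℝ≥0∞) = 1 + 1 := by norm_num
      rw [this, add_mul, one_mul]
      exact add_le_add (le_max_left _ _) (le_max_right _ _)
    exact hl.continuous
  continuous_neg := by
    have hl : Isometry fun x : G => -x := by
      intro x y
      rw [← hinv (x + y) (-x) (-y), edist_comm x y]
      congr 1 <;> abel
    exact hl.continuous

theorem Good.balls [MeasurableSpace G] [BorelSpace G] [LocallyCompactSpace G]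
    (h : Good m T β X0 c q Cd Dm D f u F) (hu : Measurable u)
    (B : Set X) (hB : MeasurableSet B) (hBX : B ⊆ X0) (hB0 : m B ≠ 0)
    (hBT : ∀ x ∈ B, T x ∈ B) (ε : ℝ≥0∞) (hε : 0 < ε) :
    ∃ g : G, m (B ∩ u ⁻¹' (Metric.eball g ε)) ≠ 0 := by
  have := topGroup_of_inv h.hinv
  obtain ⟨K, hKc, hK0⟩ := exists_compact_mem_nhds (0 : G)
  obtain ⟨E, hEc, hE⟩ := hKc.isSeparable.union h.separable_f
  set H0 : AddSubgroup G := (FreeAbelianGroup.lift (Subtype.val : E → G)).range with hH0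
  have hEH0 : E ⊆ (H0 : Set G) := fun e he =>
    ⟨FreeAbelianGroup.of ⟨e, he⟩, FreeAbelianGroup.lift_apply_of _ _⟩
  have hH0c : Countable H0 := by
    have : Countable E := hEc
    exact Set.countable_range (FreeAbelianGroup.lift (Subtype.val : E → G))
  set H := H0.topologicalClosure with hH
  have hEH : closure E ⊆ (H : Set G) := by
    rw [hH, AddSubgroup.topologicalClosure_coe]
    exact closure_mono hEH0
  have hHo : IsOpen (H : Set G) :=
    AddSubgroup.isOpen_of_mem_nhds H (g := 0)
      (mem_of_superset hK0 ((Set.subset_union_left.trans hE).trans hEH))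
  have hfH : ∀ x ∈ X0, f x ∈ H := fun x hx => hEH (hE (Or.inr ⟨x, hx, rfl⟩))
  obtain ⟨p, hp⟩ := h.atom (fun x => (QuotientAddGroup.mk (u x) : G ⧸ H)) (by
      intro S
      have hd : DiscreteTopology (G ⧸ H) := QuotientAddGroup.discreteTopology hHo
      have ho : IsOpen ((QuotientAddGroup.mk : G → G ⧸ H) ⁻¹' S) :=
        (isOpen_discrete S).preimage continuous_quot_mk
      exact hu ho.measurableSet) (by
      intro x hx
      refine QuotientAddGroup.eq.2 ?_
      have : -u (T x) + u x = f x := by rw [h.cob x hx]; abel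
      rw [this]; exact hfH x hx) B hB hBX hB0 hBT
  obtain ⟨g, rfl⟩ := QuotientAddGroup.mk_surjective p
  by_contra! hcon
  refine hp (measure_mono_null (t := ⋃ e : H0, B ∩ u ⁻¹' (Metric.eball (g + e) ε)) ?_
    (measure_iUnion_null fun e => hcon _))
  rintro x ⟨hxB, hxp⟩
  have hx : -g + u x ∈ closure (H0 : Set G) := by
    rw [← AddSubgroup.topologicalClosure_coe]
    exact QuotientAddGroup.eq.1 (Eq.symm hxp)
  obtain ⟨e, he, hlt⟩ := EMetric.mem_closure_iff.1 hx ε hε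
  refine Set.mem_iUnion.2 ⟨⟨e, he⟩, hxB, ?_⟩
  rw [← h.hinv g] at hlt
  simpa using hlt

/-- `u` is `C`-Lipschitz on a full measure subset of `Z`. -/
def LipC (m : Measure X) (u : X → G) (Z : Set X) (C : ℝ≥0∞) : Prop :=
  ∃ Ω : Set X, Ω ⊆ Z ∧ m (Z \ Ω) = 0 ∧ ∀ x ∈ Ω, ∀ y ∈ Ω, edist (u x) (u y) ≤ C * edist x y

theorem Good.livsic [MeasurableSpace G] [BorelSpace G] [LocallyCompactSpace G]
    (h : Good m T β X0 c q Cd Dm D f u F) (hu : Measurable u)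
    (B : Set X) (hB : MeasurableSet B) (hBX : B ⊆ X0) (hB0 : m B ≠ 0)
    (hBT : ∀ x ∈ B, T x ∈ B) :
    ∃ j, (β j ∩ B).Nonempty ∧ ∃ C, C ≠ ⊤ ∧ LipC m u (β j) C := by
  obtain ⟨C, hC, hCx⟩ := h.phi_bound
  set ε : ℕ → ℝ≥0∞ := fun k => 2⁻¹ ^ (k + 1) with hεd
  have hε0 : ∀ k, 0 < ε k := fun k => ENNReal.pow_pos (by simp) _
  have hstep : ∀ k, ∃ E : Set X, ∃ j ∈ F, E ⊆ B ∧ m (β j \ E) ≤ ε k ∧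
      ∀ x ∈ E, ∀ y ∈ E, edist (u x) (u y) ≤ 2 * ε k + C * edist x y := by
    intro k
    obtain ⟨g, hg⟩ := h.balls hu B hB hBX hB0 hBT (ε k) (hε0 k)
    obtain ⟨w, hw, j, hj, hjm⟩ := h.key _ (hB.inter (hu Metric.isOpen_eball.measurableSet)) hg
      (fun w => phi q D w ≤ C) (hCx.mono fun x hx _ hx0 => hx hx0) (ε k) (hε0 k).ne'
    refine ⟨_, j, hj, ?_, hjm, ?_⟩
    · rintro _ ⟨x, hx, rfl⟩
      have : ∀ n, T^[n] x ∈ B := by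
        intro n
        induction n with
        | zero => exact hx.2.1
        | succ n ih => rw [Function.iterate_succ_apply']; exact hBT _ ih
      exact this _
    · rintro _ ⟨x, hx, rfl⟩ _ ⟨y, hy, rfl⟩
      refine (h.cyl_u w x y hx.1 hy.1).trans (add_le_add ?_ (by gcongr))
      refine (edist_triangle_right _ _ g).trans ?_
      rw [two_mul]
      exact add_le_add (le_of_lt hx.2.2) (le_of_lt hy.2.2)
  choose E jj hjF hEB hEm hEu using hstep
  obtain ⟨j, hj⟩ : ∃ j, ∃ᶠ k in atTop, jj k = j := by
    by_contra! hcon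
    have : ∀ᶠ k in (atTop : Filter ℕ), ∀ j ∈ F, jj k ≠ j :=
      (eventually_all_finset F).2 fun j _ => hcon j
    obtain ⟨k, hk⟩ := this.exists
    exact hk _ (hjF k) rfl
  classical
  set N : ℕ → Set X := fun k => if jj k = j then β j \ E k else ∅ with hN
  have hNs : ∑' k, m (N k) ≠ ⊤ := by
    have hle : ∑' k, m (N k) ≤ ∑' k, ε k := by
      refine ENNReal.tsum_le_tsum fun k => ?_
      by_cases hk : jj k = j
      · simp only [hN, hk, if_true]
        rw [← hk]; exact hEm k
      · simp [hN, hk]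
    refine ne_top_of_le_ne_top ?_ hle
    simp only [hεd]
    rw [ENNReal.tsum_geometric_add_one]
    norm_num
  have hlim := measure_limsup_atTop_eq_zero hNs
  set Ω := β j \ limsup N atTop with hΩ
  have hev : ∀ x ∈ Ω, ∀ᶠ k in atTop, jj k = j → x ∈ E k := by
    rintro x ⟨hxj, hx⟩
    rw [mem_limsup_iff_frequently_mem, not_frequently] at hx
    filter_upwards [hx] with k hk hkj
    by_contra hxE
    exact hk (by simp only [hN, hkj, if_true]; exact ⟨hxj, hxE⟩)
  have hΩm : m (β j \ Ω) = 0 := by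
    refine measure_mono_null ?_ hlim
    intro x hx
    by_contra hx'
    exact hx.2 ⟨hx.1, hx'⟩
  refine ⟨j, ?_, C, hC, Ω, Set.sdiff_subset, hΩm, ?_⟩
  · have : Ω.Nonempty := by
      by_contra h0
      rw [Set.not_nonempty_iff_eq_empty.1 h0] at hΩm
      exact h.pos j (by simpa using hΩm)
    obtain ⟨x, hx⟩ := this
    obtain ⟨k, hk, hxk⟩ := (hj.and_eventually (hev x hx)).exists
    exact ⟨x, hx.1, hEB k (hxk hk)⟩
  · intro x hx y hy
    have ht : Tendsto (fun k => 2 * ε k + C * edist x y) atTop (nhds (2 * 0 + C * edist x y)) := by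
      refine Tendsto.add (ENNReal.Tendsto.const_mul ?_ (Or.inr (by simp))) tendsto_const_nhds
      exact (ENNReal.tendsto_pow_atTop_nhds_zero_of_lt_one (by norm_num)).comp
        (tendsto_add_atTop_nat 1)
    rw [mul_zero, zero_add] at ht
    refine ge_of_tendsto_of_frequently ht ?_
    refine (hj.and_eventually ((hev x hx).and (hev y hy))).mono ?_
    rintro k ⟨hk, h1, h2⟩
    exact hEu k x (h1 hk) y (h2 hk)

theorem Good.lip_step (h : Good m T β X0 c q Cd Dm D f u F) (i j : ι) (C : ℝ≥0∞)
    (hij : m (β j \ T '' β i) = 0) (hi : LipC m u (β i) C) :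
    LipC m u (β j) (q * (C + D i)) := by
  obtain ⟨Ω, hΩ, hm, hl⟩ := hi
  refine ⟨β j ∩ T '' Ω, Set.inter_subset_left, ?_, ?_⟩
  · refine measure_mono_null (t := (β j \ T '' β i) ∪ T '' (β i \ Ω)) ?_ (measure_union_null hij
      (h.nullimg _ (Set.sdiff_subset.trans (h.sub i)) hm))
    rintro y ⟨hy, hy'⟩
    by_cases hyi : y ∈ T '' β i
    · obtain ⟨x, hx, rfl⟩ := hyi
      exact Or.inr ⟨x, ⟨hx, fun hxΩ => hy' ⟨hy, x, hxΩ, rfl⟩⟩, rfl⟩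
    · exact Or.inl ⟨hy, hyi⟩
  · rintro _ ⟨-, x, hx, rfl⟩ _ ⟨-, y, hy, rfl⟩
    calc _ ≤ _ := h.edist_step x y (h.sub i (hΩ hx)) (h.sub i (hΩ hy))
      _ ≤ C * edist x y + D i * edist x y :=
        add_le_add (hl x hx y hy) (h.lip i x (hΩ hx) y (hΩ hy))
      _ = (C + D i) * edist x y := by ring
      _ ≤ (C + D i) * (q * edist (T x) (T y)) := by
        gcongr; exact h.exp i x (hΩ hx) y (hΩ hy)
      _ = _ := by ring

theorem Good.all_lip [MeasurableSpace G] [BorelSpace G] [LocallyCompactSpace G]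
    (h : Good m T β X0 c q Cd Dm D f u F) (hu : Measurable u) (i : ι) :
    ∃ C, C ≠ ⊤ ∧ LipC m u (β i) C := by
  have := h.cnt
  have hqt : q ≠ ⊤ := (h.q_lt.trans one_lt_top).ne
  set S : Set ι := {i | ∃ C, C ≠ ⊤ ∧ LipC m u (β i) C} with hS
  by_contra hi
  set Gd : Set X := ⋃ i ∈ S, β i with hGd
  have hGm : MeasurableSet Gd := MeasurableSet.biUnion (Set.to_countable S) fun i _ => h.meas i
  -- forward invariance of the good part up to null sets
  have hfw : m (Gd \ T ⁻¹' Gd) = 0 := by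
    refine measure_mono_null (t := ⋃ i : S, ⋃ j : (Sᶜ : Set ι), β i ∩ T ⁻¹' (β j)) ?_ ?_
    · rintro x ⟨hx, hx'⟩
      obtain ⟨i, hiS, hxi⟩ := Set.mem_iUnion₂.1 hx
      have hTx := h.mem_c _ (h.maps x (h.sub i hxi))
      refine Set.mem_iUnion.2 ⟨⟨i, hiS⟩, Set.mem_iUnion.2 ⟨⟨c (T x), fun hc => hx' ?_⟩, hxi, hTx⟩⟩
      exact Set.mem_iUnion₂.2 ⟨_, hc, hTx⟩
    · refine measure_iUnion_null fun i => measure_iUnion_null fun j => ?_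
      rcases h.markov i j with h0 | h0
      · obtain ⟨C, hC, hL⟩ := i.2
        exact absurd ⟨_, ENNReal.mul_ne_top hqt (ENNReal.add_ne_top.2 ⟨hC, h.D_ne i⟩),
          h.lip_step i j C h0 hL⟩ j.2
      · refine le_antisymm ((h.le_image _).trans ?_) bot_le
        rw [Set.image_inter_preimage, Set.inter_comm]
        exact h0.le
  have hbw : m (T ⁻¹' Gd \ Gd) = 0 := by
    have e : m (T ⁻¹' Gd) = m Gd := h.mp.measure_preimage hGm.nullMeasurableSet
    have e1 := measure_inter_add_sdiff (μ := m) (T ⁻¹' Gd) hGm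
    have e2 := measure_inter_add_sdiff (μ := m) Gd (h.mp.measurable hGm)
    rw [hfw, add_zero, Set.inter_comm] at e2
    rw [e, e2] at e1
    exact (ENNReal.add_right_inj (measure_ne_top m Gd)).1 (by rw [e1, add_zero])
  set B0 : Set X := X0 \ Gd with hB0
  have hB0m : MeasurableSet B0 := h.meas0.diff hGm
  set B : Set X := ⋂ n : ℕ, T^[n] ⁻¹' B0 with hBd
  have hBm : MeasurableSet B := MeasurableSet.iInter fun n => (h.mp.measurable.iterate n) hB0m
  have hBB0 : B ⊆ B0 := fun x hx => by simpa using Set.mem_iInter.1 hx 0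
  have hnull : m (B0 \ B) = 0 := by
    refine measure_mono_null (t := ⋃ n : ℕ, T^[n] ⁻¹' (T ⁻¹' Gd \ Gd)) ?_
      (measure_iUnion_null fun n => ?_)
    · rintro x ⟨hx, hxB⟩
      by_contra hcon
      apply hxB
      refine Set.mem_iInter.2 fun n => ?_
      induction n with
      | zero => exact hx
      | succ n ih =>
        refine ⟨h.iter_maps _ x hx.1, fun hg => hcon (Set.mem_iUnion.2 ⟨n, ?_, ih.2⟩)⟩
        rw [Function.iterate_succ_apply'] at hg
        exact hg
    · rw [(h.mp.iterate n).measure_preimage ((h.mp.measurable hGm).diff hGm).nullMeasurableSet, hbw]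
  have hBpos : m B ≠ 0 := by
    intro h0
    refine h.pos i (measure_mono_null ?_ (measure_union_null hnull h0))
    intro x hx
    have hxB0 : x ∈ B0 := by
      refine ⟨h.sub i hx, fun hg => ?_⟩
      obtain ⟨k, hk, hxk⟩ := Set.mem_iUnion₂.1 hg
      rw [← h.c_eq k x hxk, h.c_eq i x hx] at hk
      exact hi hk
    by_cases hxB : x ∈ B
    · exact Or.inr hxB
    · exact Or.inl ⟨hxB0, hxB⟩
  obtain ⟨j, ⟨x, hxj, hxB⟩, hjS⟩ := h.livsic hu B hBm (hBB0.trans Set.sdiff_subset) hBpos (by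
    intro x hx
    refine Set.mem_iInter.2 fun n => ?_
    exact Set.mem_iInter.1 hx (n + 1))
  exact (hBB0 hxB).2 (Set.mem_iUnion₂.2 ⟨j, hjS, hxj⟩)

theorem Good.unif [MeasurableSpace G] [BorelSpace G] [LocallyCompactSpace G]
    (h : Good m T β X0 c q Cd Dm D f u F) (hu : Measurable u) :
    ∃ C, C ≠ ⊤ ∧ ∀ i, ∃ C' ≤ C, LipC m u (β i) C' := by
  choose K hK hL using h.all_lip hu
  have hqt : q ≠ ⊤ := (h.q_lt.trans one_lt_top).ne
  refine ⟨∑ j ∈ F, q * (K j + D j), ?_, fun i => ?_⟩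
  · exact ENNReal.sum_ne_top.2 fun j _ =>
      ENNReal.mul_ne_top hqt (ENNReal.add_ne_top.2 ⟨hK j, h.D_ne j⟩)
  · obtain ⟨j, hj, hij⟩ := h.bip2 i
    exact ⟨_, Finset.single_le_sum (f := fun j => q * (K j + D j)) (fun _ _ => bot_le) hj,
      h.lip_step j i _ hij (hL j)⟩

end good

theorem essLip_att [MetricSpace X] [MetricSpace G] [MeasurableSpace X]
    (m : Measure X) (f : X → G) (Z : Set X) (hfin : essLip m f Z ≠ ⊤) :
    LipC m f Z (essLip m f Z) := by
  have hn : ∀ n : ℕ, ∃ C < essLip m f Z + (n + 1 : ℝ≥0∞)⁻¹, LipC m f Z C := by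
    intro n
    have : essLip m f Z < essLip m f Z + (n + 1 : ℝ≥0∞)⁻¹ :=
      ENNReal.lt_add_right hfin (by simp)
    obtain ⟨C, hC, hlt⟩ := sInf_lt_iff.1 this
    exact ⟨C, hlt, hC⟩
  choose C hC Ω hΩ hm hl using hn
  refine ⟨⋂ n, Ω n, (Set.iInter_subset _ 0).trans (hΩ 0), ?_, fun x hx y hy => ?_⟩
  · rw [Set.sdiff_iInter]
    exact measure_iUnion_null hm
  · have ht : Tendsto (fun n : ℕ => (essLip m f Z + (n + 1 : ℝ≥0∞)⁻¹) * edist x y) atTop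
        (nhds ((essLip m f Z + 0) * edist x y)) := by
      refine ENNReal.Tendsto.mul_const (Tendsto.add tendsto_const_nhds ?_)
        (Or.inr (edist_ne_top x y))
      have := ENNReal.tendsto_inv_nat_nhds_zero.comp (tendsto_add_atTop_nat 1)
      refine this.congr fun n => ?_
      simp
    rw [add_zero] at ht
    refine ge_of_tendsto' ht fun n => ?_
    refine (hl n x (Set.mem_iInter.1 hx n) y (Set.mem_iInter.1 hy n)).trans ?_
    gcongr
    exact (hC n).le

section setup

variable [MetricSpace X] [MeasurableSpace X] {m : Measure X} [IsProbabilityMeasure m]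
  {T : X → X} {α : ι → Set X} {lam : ℝ}

theorem GibbsMarkov.null_image (h : GibbsMarkov m T α lam) (i : ι) (s : Set X) (hs : s ⊆ α i)
    (h0 : m s = 0) : m (T '' s) = 0 := by
  obtain ⟨g, -, hg, -⟩ := h.distortion
  have hsub : s ⊆ toMeasurable m s ∩ α i := Set.subset_inter (subset_toMeasurable _ _) hs
  refine measure_mono_null (Set.image_mono hsub) ?_
  rw [hg i _ Set.inter_subset_right ((measurableSet_toMeasurable _ _).inter (h.meas i))]
  refine setLIntegral_measure_zero _ _ (measure_mono_null Set.inter_subset_left ?_)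
  rw [measure_toMeasurable, h0]

theorem GibbsMarkov.image_nm (h : GibbsMarkov m T α lam) (i : ι) :
    NullMeasurableSet (T '' α i) m := by
  have := h.countable
  obtain ⟨s, hs⟩ := h.markov i
  have hm : MeasurableSet (⋃ j ∈ s, α j) :=
    MeasurableSet.biUnion (Set.to_countable s) fun i _ => h.meas i
  exact hm.nullMeasurableSet.congr (measure_symmDiff_eq_zero_iff.1 hs).symm

theorem GibbsMarkov.nm_meas (h : GibbsMarkov m T α lam) (i : ι) (s : Set X) (hs : s ⊆ α i)
    (hsm : MeasurableSet s) : NullMeasurableSet (T '' s) m := by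
  obtain ⟨g, -, hg, -⟩ := h.distortion
  set t := α i \ s with ht
  have htm : MeasurableSet t := (h.meas i).diff hsm
  have hadd : m (T '' s) + m (T '' t) = m (T '' α i) := by
    rw [hg i s hs hsm, hg i t Set.sdiff_subset htm, hg i _ subset_rfl (h.meas i),
      ← lintegral_union htm Set.disjoint_sdiff_right, Set.union_sdiff_cancel hs]
  set P := toMeasurable m (T '' s) with hP
  set R := toMeasurable m (T '' t) with hR
  have hPm : MeasurableSet P := measurableSet_toMeasurable _ _
  have hRm : MeasurableSet R := measurableSet_toMeasurable _ _
  have hu : T '' α i = T '' s ∪ T '' t := by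
    rw [← Set.image_union, Set.union_sdiff_cancel hs]
  have hPR : m (P ∩ R) = 0 := by
    have e := measure_union_add_inter (μ := m) P hRm
    rw [hP, hR, measure_toMeasurable, measure_toMeasurable, hadd, ← hP, ← hR] at e
    have hle : m (T '' α i) ≤ m (P ∪ R) := by
      rw [hu]
      exact measure_mono (Set.union_subset_union (subset_toMeasurable _ _)
        (subset_toMeasurable _ _))
    have h2 : m (P ∪ R) + m (P ∩ R) ≤ m (P ∪ R) + 0 := by rw [e, add_zero]; exact hle
    exact le_antisymm ((ENNReal.add_le_add_iff_left (by finiteness)).1 h2) bot_le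
  have hdisj : Disjoint (T '' s) (T '' t) := by
    rw [Set.disjoint_left]
    rintro _ ⟨x, hx, rfl⟩ ⟨y, hy, hxy⟩
    have := h.inj i hy.1 (hs hx) hxy
    exact hy.2 (this ▸ hx)
  have hnull : NullMeasurableSet (P ∩ T '' α i) m := hPm.nullMeasurableSet.inter (h.image_nm i)
  refine hnull.congr ?_
  have hsubs : T '' s ⊆ P ∩ T '' α i :=
    Set.subset_inter (subset_toMeasurable _ _) (Set.image_mono hs)
  rw [← measure_symmDiff_eq_zero_iff]
  refine measure_mono_null ?_ hPR
  rintro y (⟨⟨hyP, hyα⟩, hys⟩ | ⟨hys, hn⟩)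
  · rw [hu] at hyα
    exact ⟨hyP, subset_toMeasurable _ _ (hyα.resolve_left hys)⟩
  · exact absurd (hsubs hys) hn

theorem GibbsMarkov.image_reduce (h : GibbsMarkov m T α lam) (i : ι) (s : Set X) (hs : s ⊆ α i)
    (hsm : NullMeasurableSet s m) : ∃ s' ⊆ s, MeasurableSet s' ∧ m s' = m s ∧
      T '' s' =ᵐ[m] T '' s := by
  obtain ⟨s', hs', hm', he⟩ := hsm.exists_measurable_subset_ae_eq
  refine ⟨s', hs', hm', measure_congr he, ?_⟩
  have h0 : m (s \ s') = 0 := (ae_eq_set.1 he).2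
  rw [← measure_symmDiff_eq_zero_iff]
  refine measure_mono_null ?_ (h.null_image i (s \ s') (Set.sdiff_subset.trans hs) h0)
  rintro y (⟨⟨x, hx, rfl⟩, hy⟩ | ⟨⟨x, hx, rfl⟩, hy⟩)
  · exact absurd ⟨x, hs' hx, rfl⟩ hy
  · exact ⟨x, ⟨hx, fun hx' => hy ⟨x, hx', rfl⟩⟩, rfl⟩

theorem GibbsMarkov.nm (h : GibbsMarkov m T α lam) (i : ι) (s : Set X) (hs : s ⊆ α i)
    (hsm : NullMeasurableSet s m) : NullMeasurableSet (T '' s) m := by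
  obtain ⟨s', hs', hm', -, he⟩ := h.image_reduce i s hs hsm
  exact (h.nm_meas i s' (hs'.trans hs) hm').congr he

theorem dist_step (g : X → ℝ) (hg : ∀ x, 0 < g x) (C : ℝ) (hC : 0 < C) (s t : Set X)
    (hs : MeasurableSet s) (ht : MeasurableSet t)
    (hgs : m (T '' s) = ∫⁻ x in s, ENNReal.ofReal (g x)⁻¹ ∂m)
    (hgt : m (T '' t) = ∫⁻ x in t, ENNReal.ofReal (g x)⁻¹ ∂m)
    (hd : ∀ x ∈ s, ∀ y ∈ t, |1 - g y / g x| ≤ C * dist (T y) (T x))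
    (r : ℝ≥0∞) (hr : r ≠ ⊤) (hrd : ∀ x ∈ s, ∀ y ∈ t, edist (T x) (T y) ≤ r) :
    m (T '' s) * m t ≤ (1 + ENNReal.ofReal C * r) * m s * m (T '' t) := by
  set κ := 1 + ENNReal.ofReal C * r with hκ
  have hκt : κ ≠ ⊤ := by rw [hκ]; finiteness
  have hκ' : κ = ENNReal.ofReal (1 + C * r.toReal) := by
    rw [ENNReal.ofReal_add (by norm_num) (by positivity), ENNReal.ofReal_mul hC.le,
      ENNReal.ofReal_toReal hr, ENNReal.ofReal_one]
  have hxy : ∀ x ∈ s, ∀ y ∈ t, ENNReal.ofReal (g x)⁻¹ ≤ κ * ENNReal.ofReal (g y)⁻¹ := by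
    intro x hx y hy
    rw [hκ', ← ENNReal.ofReal_mul (by positivity)]
    apply ENNReal.ofReal_le_ofReal
    have h1 := (abs_le.1 (hd x hx y hy)).1
    have h2 : dist (T y) (T x) ≤ r.toReal := by
      rw [dist_comm, dist_edist]
      exact ENNReal.toReal_mono hr (hrd x hx y hy)
    have h3 : g y / g x ≤ 1 + C * r.toReal := by nlinarith
    have hgy := hg y
    have hgx := hg x
    rw [← div_eq_mul_inv, le_div_iff₀ hgy]
    rw [div_eq_mul_inv, mul_comm] at h3
    exact h3
  have hone : ∀ y ∈ t, m (T '' s) ≤ κ * m s * ENNReal.ofReal (g y)⁻¹ := by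
    intro y hy
    rw [hgs]
    calc _ ≤ ∫⁻ x in s, κ * ENNReal.ofReal (g y)⁻¹ ∂m :=
          setLIntegral_mono' hs fun x hx => hxy x hx y hy
      _ = _ := by rw [setLIntegral_const]; ring
  calc m (T '' s) * m t = ∫⁻ y in t, m (T '' s) ∂m := by rw [setLIntegral_const]
    _ ≤ ∫⁻ y in t, κ * m s * ENNReal.ofReal (g y)⁻¹ ∂m := setLIntegral_mono' ht hone
    _ = κ * m s * m (T '' t) := by
      rw [lintegral_const_mul' _ _ (ENNReal.mul_ne_top hκt (by finiteness)), hgt]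

theorem GibbsMarkov.toGood [MetricSpace G] [AddCommGroup G]
    (hGM : GibbsMarkov m T α lam) (hinv : ∀ g x y : G, dist (g + x) (g + y) = dist x y)
    (hpres : MeasurePreserving T m m) (f u : X → G)
    (hf : (∑' i, m (α i) * essLip m f (α i)) ≠ ⊤)
    (hcob : ∀ᵐ x ∂m, f x = u x - u (T x)) (i₁ : ι) :
    ∃ (X0 : Set X) (c : X → ι) (q Cd Dm : ℝ≥0∞) (F : Finset ι), 
      Good m T (fun i => α i ∩ X0) X0 c q Cd Dm (fun i => essLip m f (α i)) f u F := by
  classical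
  have := hGM.countable
  have hDne : ∀ i, essLip m f (α i) ≠ ⊤ := by
    intro i hi
    have := ENNReal.ne_top_of_tsum_ne_top hf i
    rw [hi, ENNReal.mul_top (hGM.pos i).ne'] at this
    exact this rfl
  choose Ωf hΩf hΩfm hΩfl using fun i => essLip_att m f (α i) (hDne i)
  choose Ωe hΩe hΩem hΩel using hGM.expand
  obtain ⟨g, hg0, hg, C, hC, hgd⟩ := hGM.distortion
  choose Ωd hΩd hΩdm hΩdl using hgd
  set N0 : Set X := (⋃ i, α i)ᶜ ∪ (⋃ i, (α i \ Ωf i) ∪ (α i \ Ωe i) ∪ (α i \ Ωd i)) ∪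
    {x | ¬ f x = u x - u (T x)} with hN0
  have hN00 : m N0 = 0 := by
    refine measure_union_null (measure_union_null hGM.cover (measure_iUnion_null fun i => ?_)) hcob
    exact measure_union_null (measure_union_null (hΩfm i) (hΩem i)) (hΩdm i)
  set N := toMeasurable m N0 with hN
  have hNm : MeasurableSet N := measurableSet_toMeasurable _ _
  have hNn : m N = 0 := by rw [hN, measure_toMeasurable, hN00]
  have hNsub : N0 ⊆ N := subset_toMeasurable _ _
  set X0 : Set X := ⋂ n : ℕ, T^[n] ⁻¹' Nᶜ with hX0
  have hX0m : MeasurableSet X0 :=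
    MeasurableSet.iInter fun n => (hGM.measT.iterate n) hNm.compl
  have hX0c : m X0ᶜ = 0 := by
    rw [hX0, Set.compl_iInter]
    refine measure_iUnion_null fun n => ?_
    rw [← Set.preimage_compl, compl_compl, (hpres.iterate n).measure_preimage
      hNm.nullMeasurableSet, hNn]
  have hX0N : ∀ x ∈ X0, x ∉ N0 := fun x hx hxN => (Set.mem_iInter.1 hx 0) (hNsub hxN)
  have hmaps : ∀ x ∈ X0, T x ∈ X0 := fun x hx =>
    Set.mem_iInter.2 fun n => Set.mem_iInter.1 hx (n + 1)
  have hcov : ∀ x ∈ X0, ∃ i, x ∈ α i := by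
    intro x hx
    by_contra hcon
    exact hX0N x hx (Or.inl (Or.inl fun hx' => hcon (Set.mem_iUnion.1 hx')))
  have hmemf : ∀ i, ∀ x ∈ α i ∩ X0, x ∈ Ωf i := by
    rintro i x ⟨hx, hx0⟩
    by_contra hcon
    exact hX0N x hx0 (Or.inl (Or.inr (Set.mem_iUnion.2 ⟨i, Or.inl (Or.inl ⟨hx, hcon⟩)⟩)))
  have hmeme : ∀ i, ∀ x ∈ α i ∩ X0, x ∈ Ωe i := by
    rintro i x ⟨hx, hx0⟩
    by_contra hcon
    exact hX0N x hx0 (Or.inl (Or.inr (Set.mem_iUnion.2 ⟨i, Or.inl (Or.inr ⟨hx, hcon⟩)⟩)))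
  have hmemd : ∀ i, ∀ x ∈ α i ∩ X0, x ∈ Ωd i := by
    rintro i x ⟨hx, hx0⟩
    by_contra hcon
    exact hX0N x hx0 (Or.inl (Or.inr (Set.mem_iUnion.2 ⟨i, Or.inr ⟨hx, hcon⟩⟩)))
  have hcob0 : ∀ x ∈ X0, f x = u x - u (T x) := by
    intro x hx
    by_contra hcon
    exact hX0N x hx (Or.inr hcon)
  set c : X → ι := fun x => if hx : ∃ i, x ∈ α i then hx.choose else i₁ with hc
  have hcmem : ∀ x ∈ X0, x ∈ α (c x) := by
    intro x hx
    have h' := hcov x hx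
    simp only [hc, dif_pos h']
    exact h'.choose_spec
  have huniq : ∀ i j x, x ∈ α i → x ∈ α j → i = j := by
    intro i j x hi hj
    by_contra hne
    exact Set.disjoint_left.1 (hGM.disj hne) hi hj
  have hmeas0 : ∀ i, m (α i \ X0) = 0 := fun i =>
    measure_mono_null (fun x hx => hx.2) hX0c
  have himg : ∀ i, m (T '' α i \ T '' (α i ∩ X0)) = 0 := by
    intro i
    refine measure_mono_null ?_ (hGM.null_image i _ Set.sdiff_subset (hmeas0 i))
    rintro _ ⟨⟨x, hx, rfl⟩, hy⟩
    exact ⟨x, ⟨hx, fun hx0 => hy ⟨x, ⟨hx, hx0⟩, rfl⟩⟩, rfl⟩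
  have hred : ∀ i j, m (α j \ T '' α i) = 0 → m ((α j ∩ X0) \ T '' (α i ∩ X0)) = 0 := by
    intro i j hij
    refine measure_mono_null ?_ (measure_union_null hij (himg i))
    rintro x ⟨hx, hx'⟩
    by_cases hxi : x ∈ T '' α i
    · exact Or.inr ⟨hxi, hx'⟩
    · exact Or.inl ⟨hx.1, hxi⟩
  have hβle : ∀ i, m (α i ∩ X0) ≤ m (α i) := fun i => measure_mono Set.inter_subset_left
  obtain ⟨F, hF⟩ := hGM.bip
  obtain ⟨R, hR⟩ := Metric.isBounded_iff.1 hGM.bounded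
  have hlam0 : 0 < lam := one_pos.trans hGM.one_lt_lam
  refine ⟨X0, c, ENNReal.ofReal lam⁻¹, ENNReal.ofReal C, ENNReal.ofReal R, F, ?_⟩
  constructor
  · exact hGM.countable
  · exact hpres
  · exact hX0m
  · exact hX0c
  · exact hmaps
  · exact fun i => (hGM.meas i).inter hX0m
  · exact fun i => Set.inter_subset_right
  · exact fun x hx => ⟨hcmem x hx, hx⟩
  · exact fun i x hx => huniq _ _ x (hcmem x hx.2) hx.1
  · intro i h0
    refine (hGM.pos i).ne' (measure_mono_null ?_ (measure_union_null h0 (hmeas0 i)))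
    rw [Set.inter_union_sdiff]
  · intro N hN h0
    refine measure_mono_null (t := ⋃ i, T '' (N ∩ α i)) ?_ (measure_iUnion_null fun i =>
      hGM.null_image i _ Set.inter_subset_right (measure_mono_null Set.inter_subset_left h0))
    rintro _ ⟨x, hx, rfl⟩
    obtain ⟨i, hi⟩ := hcov x (hN hx)
    exact Set.mem_iUnion.2 ⟨i, x, ⟨hx, hi⟩, rfl⟩
  · exact fun i s hs hsm => hGM.nm i s (hs.trans Set.inter_subset_left) hsm
  · intro i s hs t ht hsm htm r hr hrd
    have hsα := hs.trans Set.inter_subset_left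
    have htα := ht.trans Set.inter_subset_left
    obtain ⟨s', hs', hsm', hse, hsT⟩ := hGM.image_reduce i s hsα hsm
    obtain ⟨t', ht', htm', hte, htT⟩ := hGM.image_reduce i t htα htm
    rw [← hse, ← hte, ← measure_congr hsT, ← measure_congr htT]
    refine dist_step g hg0 C hC s' t' hsm' htm' (hg i s' (hs'.trans hsα) hsm')
      (hg i t' (ht'.trans htα) htm') ?_ r hr (fun x hx y hy => hrd x (hs' hx) y (ht' hy))
    intro x hx y hy
    exact hΩdl i y (hmemd i y (ht (ht' hy))) x (hmemd i x (hs (hs' hx)))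
  · intro i j
    obtain ⟨S, hS⟩ := hGM.markov i
    by_cases hj : j ∈ S
    · left
      refine hred i j (measure_mono_null ?_ hS)
      exact fun x hx => Or.inr ⟨Set.mem_iUnion₂.2 ⟨j, hj, hx.1⟩, hx.2⟩
    · right
      refine measure_mono_null ?_ hS
      rintro x ⟨hx, hx'⟩
      refine Or.inl ⟨Set.image_mono Set.inter_subset_left hx', fun hxS => ?_⟩
      obtain ⟨k, hk, hxk⟩ := Set.mem_iUnion₂.1 hxS
      exact hj (huniq _ _ x hxk hx.1 ▸ hk)
  · intro i
    obtain ⟨j, hj, hij⟩ := (hF i).2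
    exact ⟨j, hj, hred i j hij⟩
  · intro i
    obtain ⟨j, hj, hij⟩ := (hF i).1
    exact ⟨j, hj, hred j i hij⟩
  · rw [← ENNReal.ofReal_one]
    exact (ENNReal.ofReal_lt_ofReal_iff one_pos).2 (inv_lt_one_of_one_lt₀ hGM.one_lt_lam)
  · exact ENNReal.ofReal_ne_top
  · exact ENNReal.ofReal_ne_top
  · intro x y
    rw [edist_dist]
    exact ENNReal.ofReal_le_ofReal (hR (Set.mem_univ x) (Set.mem_univ y))
  · intro i x hx y hy
    rw [edist_dist, edist_dist, ← ENNReal.ofReal_mul (by positivity)]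
    apply ENNReal.ofReal_le_ofReal
    rw [inv_mul_eq_div, le_div_iff₀ hlam0, mul_comm]
    exact hΩel i x (hmeme i x hx) y (hmeme i y hy)
  · exact fun i x hx y hy => hΩfl i x (hmemf i x hx) y (hmemf i y hy)
  · exact hDne
  · refine ne_top_of_le_ne_top hf (ENNReal.tsum_le_tsum fun i => ?_)
    gcongr
    exact Set.inter_subset_left
  · exact hcob0
  · intro a x y
    rw [edist_dist, edist_dist, hinv]

end setup

/-- If `Du(α₁) < ∞` for some element `α₁` of the partition of a transitive
Gibbs-Markov map, then `Du(a) < ∞` for every `a ∈ α`, and `∑ m(a) Du(a) < ∞`. -/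
theorem gibbs_markov_Du_sum_finite
    [MetricSpace X] [MeasurableSpace X] [BorelSpace X]
    [MetricSpace G] [AddCommGroup G] [MeasurableSpace G] [BorelSpace G]
    [LocallyCompactSpace G]
    (hinv : ∀ g x y : G, dist (g + x) (g + y) = dist x y)
    (m : Measure X) [IsProbabilityMeasure m]
    (T : X → X) (hpres : MeasurePreserving T m m)
    (α : ι → Set X) (lam : ℝ) (hGM : GibbsMarkov m T α lam)
    (htrans : ∀ i j, ∃ n : ℕ, m (α j \ T^[n] '' α i) = 0)
    (f u : X → G) (hu : Measurable u)
    (hf : (∑' i, m (α i) * essLip m f (α i)) ≠ ⊤)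
    (hcob : ∀ᵐ x ∂m, f x = u x - u (T x))
    (i₁ : ι) (hi₁ : essLip m u (α i₁) ≠ ⊤) :
    (∀ i, essLip m u (α i) ≠ ⊤) ∧ (∑' i, m (α i) * essLip m u (α i)) ≠ ⊤ := by
  have := hGM.countable
  obtain ⟨X0, c, q, Cd, Dm, F, h⟩ := hGM.toGood hinv hpres f u hf hcob i₁
  obtain ⟨C, hC, hCi⟩ := h.unif hu
  have hle : ∀ i, essLip m u (α i) ≤ C := by
    intro i
    obtain ⟨C', hC', Ω, hΩ, hm, hl⟩ := hCi i
    refine le_trans (sInf_le ⟨Ω, hΩ.trans Set.inter_subset_left, ?_, hl⟩) hC'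
    refine measure_mono_null ?_ (measure_union_null hm h.conull)
    rintro x ⟨hx, hx'⟩
    by_cases hx0 : x ∈ X0
    · exact Or.inl ⟨⟨hx, hx0⟩, hx'⟩
    · exact Or.inr hx0
  refine ⟨fun i => ne_top_of_le_ne_top hC (hle i), ?_⟩
  refine ne_top_of_le_ne_top hC ?_
  calc ∑' i, m (α i) * essLip m u (α i) ≤ ∑' i, m (α i) * C :=
        ENNReal.tsum_le_tsum fun i => by gcongr; exact hle i
    _ = m (⋃ i, α i) * C := by
      rw [ENNReal.tsum_mul_right, measure_iUnion hGM.disj hGM.meas]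
    _ ≤ 1 * C := by gcongr; exact prob_le_one
    _ = C := one_mul C
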